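/- arXiv:1307.7691 — 3 statements merged into one kernel-verified Lean document; each statement's English description precedes it below -/
import Mathlib

section
/- Let p be an odd prime and n ≥ 1 an integer. For every matrix B ∈ M₂(ℤ_p) there exists a matrix A ∈ M₂(ℤ_p) such that (1 + pⁿ·A)^(pⁿ) = 1 + p^(2n)·B. (Combined with the reverse inclusion, this says that the set of pⁿ-th powers of elements of the principal congruence subgroup H_n of GL₂(ℤ_p) is exactly H_{2n}.) -/
open Polynomial Filter Topology

/-- Polynomial maps preserve congruences modulo a central element of a (noncommutative) algebra. -/
lemma Polynomial.exists_aeval_add_smul_eq {S R : Type*} [CommRing S] [Ring R] [Algebra S R]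
    (q : S[X]) (a c : R) (r : S) : ∃ d : R, aeval (a + r • c) q = aeval a q + r • d := by
  induction q using Polynomial.induction_on with
  | C z => exact ⟨0, by simp⟩
  | add f g hf hg =>
    obtain ⟨d, hd⟩ := hf
    obtain ⟨e, he⟩ := hg
    exact ⟨d + e, by rw [map_add, map_add, hd, he, smul_add]; abel⟩
  | monomial k z h =>
    obtain ⟨d, hd⟩ := h
    refine ⟨aeval a (C z * X ^ k) * c + d * a + r • (d * c), ?_⟩
    rw [pow_succ, ← mul_assoc, map_mul _ (C z * X ^ k), map_mul _ (C z * X ^ k), hd, aeval_X, aeval_X]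
    simp only [add_mul, mul_add, smul_add, smul_mul_assoc, mul_smul_comm]
    abel

/-- For odd `p` and `m ≥ 1`, the polynomial `(1 + pᵐ X)ᵖ` agrees with its linear part
`1 + pᵐ⁺¹ X` modulo `pᵐ⁺²`. -/
lemma Polynomial.exists_one_add_prime_pow_mul_X_pow_eq (S : Type*) [CommRing S] {p m : ℕ}
    (hp : p.Prime) (hodd : Odd p) (hm : 1 ≤ m) : ∃ q : S[X],
      (1 + (p : S[X]) ^ m * X) ^ p = 1 + (p : S[X]) ^ (m + 1) * (X + (p : S[X]) * q) := by
  have hp3 : 3 ≤ p := by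
    have := hp.two_le
    rcases hodd with ⟨k, hk⟩
    omega
  obtain ⟨l, rfl⟩ : ∃ l, p = l + 1 := ⟨p - 1, by omega⟩
  set P : S[X] := ((l + 1 : ℕ) : S[X]) with hP
  have hdvd : P ^ (m + 2) ∣ ∑ i ∈ Finset.range l,
      (P ^ m * X) ^ (i + 1 + 1) * ((l + 1).choose (i + 1 + 1) : S[X]) := by
    refine Finset.dvd_sum fun i hi => ?_
    have hi' := Finset.mem_range.mp hi
    rw [mul_pow, ← pow_mul]
    by_cases h : i + 1 + 1 = l + 1
    · refine Dvd.dvd.mul_right (Dvd.dvd.mul_right (pow_dvd_pow P ?_) _) _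
      have : 3 ≤ i + 1 + 1 := by omega
      nlinarith
    · have h1 : P ∣ ((l + 1).choose (i + 1 + 1) : S[X]) :=
        Nat.cast_dvd_cast (hp.dvd_choose_self (by omega) (by omega))
      have h2 : P ^ (m + 1) ∣ P ^ (m * (i + 1 + 1)) := pow_dvd_pow P (by nlinarith)
      rw [show m + 2 = m + 1 + 1 from rfl, pow_succ]
      exact mul_dvd_mul (h2.mul_right _) h1
  obtain ⟨q, hq⟩ := hdvd
  refine ⟨q, ?_⟩
  rw [add_comm, add_pow]
  simp only [one_pow, mul_one]
  rw [Finset.sum_range_succ', Finset.sum_range_succ', hq]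
  simp only [zero_add, pow_one, pow_zero, Nat.choose_one_right, Nat.choose_zero_right,
    Nat.cast_one, ← hP]
  ring

namespace PadicInt

variable {p : ℕ} [Fact p.Prime] {ι : Type*} [Fintype ι] [DecidableEq ι]

/-- A polynomial perturbation of the identity by a multiple of `p` is surjective on matrices. -/
lemma exists_add_smul_aeval_eq (q : ℤ_[p][X]) (B : Matrix ι ι ℤ_[p]) :
    ∃ A : Matrix ι ι ℤ_[p], A + (p : ℤ_[p]) • aeval A q = B := by
  have happrox (k : ℕ) : ∃ A C : Matrix ι ι ℤ_[p],
      A + (p : ℤ_[p]) • aeval A q = B + (p : ℤ_[p]) ^ k • C := by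
    induction k with
    | zero => exact ⟨B, (p : ℤ_[p]) • aeval B q, by simp⟩
    | succ k ih =>
      obtain ⟨A, C, h⟩ := ih
      obtain ⟨D, hD⟩ := q.exists_aeval_add_smul_eq A (-C) ((p : ℤ_[p]) ^ k)
      refine ⟨A + (p : ℤ_[p]) ^ k • -C, D, ?_⟩
      rw [hD, smul_add, add_add_add_comm, h, smul_smul, pow_succ',
        smul_neg]
      abel
  choose A C h using happrox
  have hcont : Continuous fun A : Matrix ι ι ℤ_[p] => A + (p : ℤ_[p]) • aeval A q :=
    continuous_id.add ((q.continuous_aeval (A := Matrix ι ι ℤ_[p])).const_smul (p : ℤ_[p]))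
  have : CompactSpace (Matrix ι ι ℤ_[p]) := inferInstanceAs (CompactSpace (ι → ι → ℤ_[p]))
  have hlim : Tendsto (fun k => B + (p : ℤ_[p]) ^ k • C k) atTop (𝓝 B) := by
    refine tendsto_pi_nhds.2 fun i => tendsto_pi_nhds.2 fun j => ?_
    have hpow : Tendsto (fun k : ℕ => ‖(p : ℤ_[p])‖ ^ k) atTop (𝓝 0) :=
      tendsto_pow_atTop_nhds_zero_of_lt_one (norm_nonneg _)
        (norm_lt_one_iff_dvd _ |>.2 dvd_rfl)
    have hzero : Tendsto (fun k => (p : ℤ_[p]) ^ k * C k i j) atTop (𝓝 0) := by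
      refine squeeze_zero_norm (fun k => ?_) hpow
      rw [norm_mul, norm_pow]
      exact mul_le_of_le_one_right (by positivity) (norm_le_one _)
    simpa using hzero.const_add (B i j)
  exact (isCompact_range hcont).isClosed.mem_of_tendsto hlim
    (Eventually.of_forall fun k => ⟨A k, h k⟩)

/-- For odd `p` and `m ≥ 1`, every element of the principal congruence subgroup of level `m + 1`
is the `p`-th power of an element of the one of level `m`. -/
lemma exists_one_add_smul_pow_prime_eq (hodd : Odd p) {m : ℕ} (hm : 1 ≤ m)
    (B : Matrix ι ι ℤ_[p]) : ∃ A : Matrix ι ι ℤ_[p],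
      (1 + (p : ℤ_[p]) ^ m • A) ^ p = 1 + (p : ℤ_[p]) ^ (m + 1) • B := by
  obtain ⟨q, hq⟩ := exists_one_add_prime_pow_mul_X_pow_eq ℤ_[p] (Fact.out : p.Prime) hodd hm
  obtain ⟨A, hA⟩ := exists_add_smul_aeval_eq q B
  refine ⟨A, ?_⟩
  have h := congrArg (aeval A) hq
  simp only [map_add, map_mul, map_pow, map_one, map_natCast, aeval_X] at h
  have hcast (k : ℕ) (M : Matrix ι ι ℤ_[p]) :
      (p : ℤ_[p]) ^ k • M = (p : Matrix ι ι ℤ_[p]) ^ k * M := by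
    rw [Algebra.smul_def, map_pow, map_natCast]
  rw [hcast, hcast, h, ← hA, Algebra.smul_def, map_natCast]

/-- Iterated version of `PadicInt.exists_one_add_smul_pow_prime_eq`. -/
lemma exists_one_add_smul_pow_prime_pow_eq (hodd : Odd p) {m : ℕ} (hm : 1 ≤ m) (k : ℕ)
    (B : Matrix ι ι ℤ_[p]) : ∃ A : Matrix ι ι ℤ_[p],
      (1 + (p : ℤ_[p]) ^ m • A) ^ (p ^ k) = 1 + (p : ℤ_[p]) ^ (m + k) • B := by
  induction k generalizing B with
  | zero => exact ⟨B, by simp⟩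
  | succ k ih =>
    obtain ⟨A, hA⟩ := exists_one_add_smul_pow_prime_eq hodd (hm.trans (Nat.le_add_right m k)) B
    obtain ⟨A', hA'⟩ := ih A
    exact ⟨A', by rw [pow_succ, pow_mul, hA', hA, add_assoc]⟩

end PadicInt


/-- Let `p` be an odd prime and `n ≥ 1`. For every matrix
`B ∈ M₂(ℤ_p)` there exists `A ∈ M₂(ℤ_p)` such that
`(1 + pⁿ·A)^(pⁿ) = 1 + p^(2n)·B`; combined with the reverse inclusion, the set
of `pⁿ`-th powers of elements of the principal congruence subgroup `H_n` of
`GL₂(ℤ_p)` is exactly `H_{2n}`. -/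
theorem exists_pow_principal_congruence_eq (p : ℕ) [Fact p.Prime] (hodd : Odd p)
    (n : ℕ) (hn : 1 ≤ n) (B : Matrix (Fin 2) (Fin 2) ℤ_[p]) :
    ∃ A : Matrix (Fin 2) (Fin 2) ℤ_[p],
      (1 + (p : ℤ_[p]) ^ n • A) ^ (p ^ n) = 1 + (p : ℤ_[p]) ^ (2 * n) • B := by
  rw [two_mul]
  exact PadicInt.exists_one_add_smul_pow_prime_pow_eq hodd hn n B
end

section
/- Let p ≥ 5 be a prime. Consider M₂(ℤ/pℤ) as a ℤ/pℤ-module on which GL₂(ℤ/pℤ) acts by conjugation (g acting as A ↦ g·A·g⁻¹). Then the ℤ/pℤ-submodules W of M₂(ℤ/pℤ) that are stable under conjugation by every element of GL₂(ℤ/pℤ) are exactly the following four: the zero submodule, the submodule of scalar matrices, the submodule of trace-zero matrices, and M₂(ℤ/pℤ) itself. In particular, M₂(ℤ/pℤ) is the internal direct sum of the scalar matrices and the trace-zero matrices, and every nonzero proper invariant submodule has ℤ/pℤ-dimension 1 or 3. -/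
open Matrix

namespace Matrix

variable {K : Type*} [Field K]

/-- A submodule of `2 × 2` matrices is conjugation invariant if it is stable under conjugation by
every invertible matrix. -/
def IsConjInvariant (W : Submodule K (Matrix (Fin 2) (Fin 2) K)) : Prop :=
  ∀ g : GL (Fin 2) K, ∀ A ∈ W, (g : Matrix (Fin 2) (Fin 2) K) * A *
    ((g⁻¹ : GL (Fin 2) K) : Matrix (Fin 2) (Fin 2) K) ∈ W

variable {W : Submodule K (Matrix (Fin 2) (Fin 2) K)}

theorem IsConjInvariant.conj_mem (hW : IsConjInvariant W) {A U V : Matrix (Fin 2) (Fin 2) K}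
    (hUV : U * V = 1) (hA : A ∈ W) : U * A * V ∈ W :=
  hW ⟨U, V, hUV, mul_eq_one_comm.mp hUV⟩ A hA

theorem IsConjInvariant.unipotent_mem (hW : IsConjInvariant W) {A N : Matrix (Fin 2) (Fin 2) K}
    (hN : N * N = 0) (hA : A ∈ W) : (1 + N) * A * (1 - N) ∈ W :=
  hW.conj_mem (by simp [mul_sub, add_mul, hN]) hA

theorem IsConjInvariant.sandwich_mem (h2 : (2 : K) ≠ 0) (hW : IsConjInvariant W)
    {A N : Matrix (Fin 2) (Fin 2) K} (hN : N * N = 0) (hA : A ∈ W) : N * A * N ∈ W := by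
  have h₁ := hW.unipotent_mem hN hA
  have h₂ := hW.unipotent_mem (N := -N) (by simp [hN]) hA
  have h₃ : (2 : K) • (N * A * N) ∈ W := by
    convert W.sub_mem (W.smul_mem 2 hA) (W.add_mem h₁ h₂) using 1
    simp only [two_smul]
    noncomm_ring
  exact (W.smul_mem_iff h2).mp h₃

theorem IsConjInvariant.commutator_mem (h2 : (2 : K) ≠ 0) (hW : IsConjInvariant W)
    {A N : Matrix (Fin 2) (Fin 2) K} (hN : N * N = 0) (hA : A ∈ W) : N * A - A * N ∈ W := by
  convert W.add_mem (W.sub_mem (hW.unipotent_mem hN hA) hA) (hW.sandwich_mem h2 hN hA) using 1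
  noncomm_ring

theorem upper_nilpotent_mul_self :
    (!![0, 1; 0, 0] : Matrix (Fin 2) (Fin 2) K) * !![0, 1; 0, 0] = 0 := by
  ext i j
  fin_cases i <;> fin_cases j <;> simp

/-- A conjugation-invariant submodule containing the upper elementary nilpotent matrix contains all
trace-zero matrices. -/
theorem IsConjInvariant.ker_trace_le_of_nilpotent_mem (h2 : (2 : K) ≠ 0) (hW : IsConjInvariant W)
    (hE : !![0, 1; 0, 0] ∈ W) : LinearMap.ker (traceLinearMap (Fin 2) K K) ≤ W := by
  have hF : !![0, 0; 1, 0] ∈ W := by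
    convert hW.conj_mem (U := !![0, 1; 1, 0]) (V := !![0, 1; 1, 0])
      (by simp [one_fin_two]) hE using 1
    ext i j
    fin_cases i <;> fin_cases j <;> simp
  have hH : !![1, 0; 0, -1] ∈ W := by
    convert hW.commutator_mem h2 upper_nilpotent_mul_self hF using 1
    ext i j
    fin_cases i <;> fin_cases j <;> simp
  intro A hA
  have htr : A 1 1 = -A 0 0 := by
    rw [LinearMap.mem_ker, traceLinearMap_apply, trace_fin_two] at hA
    linear_combination hA
  convert W.add_mem (W.add_mem (W.smul_mem (A 0 1) hE) (W.smul_mem (A 1 0) hF))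
    (W.smul_mem (A 0 0) hH) using 1
  ext i j
  fin_cases i <;> fin_cases j <;> simp [htr]

theorem mem_span_one_iff {A : Matrix (Fin 2) (Fin 2) K} :
    A ∈ Submodule.span K {(1 : Matrix (Fin 2) (Fin 2) K)} ↔
      A 0 1 = 0 ∧ A 1 0 = 0 ∧ A 0 0 = A 1 1 := by
  rw [Submodule.mem_span_singleton]
  constructor
  · rintro ⟨a, rfl⟩
    simp
  · rintro ⟨h₁, h₂, h₃⟩
    refine ⟨A 1 1, ?_⟩
    ext i j
    fin_cases i <;> fin_cases j <;> simp [h₁, h₂, h₃]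

/-- A conjugation-invariant submodule either consists of scalar matrices or contains all trace-zero
matrices. -/
theorem IsConjInvariant.le_span_one_or_ker_trace_le (h2 : (2 : K) ≠ 0) (hW : IsConjInvariant W) :
    W ≤ Submodule.span K {1} ∨ LinearMap.ker (traceLinearMap (Fin 2) K K) ≤ W := by
  refine or_iff_not_imp_left.mpr fun hle ↦ hW.ker_trace_le_of_nilpotent_mem h2 ?_
  obtain ⟨A, hA, hA'⟩ := SetLike.not_le_iff_exists.mp hle
  have of_lower_left {B : Matrix (Fin 2) (Fin 2) K} (hB : B ∈ W) (h : B 1 0 ≠ 0) :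
      !![0, 1; 0, 0] ∈ W := by
    rw [← W.smul_mem_iff h]
    convert hW.sandwich_mem h2 upper_nilpotent_mul_self hB using 1
    ext i j
    fin_cases i <;> fin_cases j <;> simp [mul_apply, vecMul, dotProduct, Fin.sum_univ_two]
  by_cases h₁₀ : A 1 0 = 0
  · by_cases h₀₁ : A 0 1 = 0
    · have hd : A 1 1 - A 0 0 ≠ 0 := fun h ↦
        hA' (mem_span_one_iff.mpr ⟨h₀₁, h₁₀, (sub_eq_zero.mp h).symm⟩)
      rw [← W.smul_mem_iff hd]
      convert hW.commutator_mem h2 upper_nilpotent_mul_self hA using 1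
      ext i j
      fin_cases i <;> fin_cases j <;> simp [mul_apply, vecMul, dotProduct, Fin.sum_univ_two, h₁₀]
    · refine of_lower_left (hW.conj_mem (U := !![0, 1; 1, 0]) (V := !![0, 1; 1, 0])
        (by simp [one_fin_two]) hA) ?_
      simpa [mul_apply, vecMul, dotProduct, Fin.sum_univ_two] using h₀₁
  · exact of_lower_left hA h₁₀

theorem isCompl_span_one_ker_trace (h2 : (2 : K) ≠ 0) :
    IsCompl (Submodule.span K {(1 : Matrix (Fin 2) (Fin 2) K)})
      (LinearMap.ker (traceLinearMap (Fin 2) K K)) := by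
  have htr : traceLinearMap (Fin 2) K K 1 ≠ 0 := by simpa using h2
  exact (Submodule.isCompl_span_singleton_of_isCoatom_of_notMem
    (LinearMap.isCoatom_ker_of_surjective (LinearMap.surjective fun h ↦ htr (by simp [h])))
    htr).symm

theorem isConjInvariant_iff (h2 : (2 : K) ≠ 0) :
    IsConjInvariant W ↔ W = ⊥ ∨ W = Submodule.span K {1} ∨
      W = LinearMap.ker (traceLinearMap (Fin 2) K K) ∨ W = ⊤ := by
  have hatom : IsAtom (Submodule.span K {(1 : Matrix (Fin 2) (Fin 2) K)}) :=
    nonzero_span_atom _ one_ne_zero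
  constructor
  · intro hW
    rcases hW.le_span_one_or_ker_trace_le h2 with h | h
    · rcases hatom.le_iff.mp h with h | h <;> simp [h]
    · have hcoatom := (isCompl_span_one_ker_trace h2).isAtom_iff_isCoatom.mp hatom
      rcases hcoatom.le_iff.mp h with h | h <;> simp [h]
  · rintro (rfl | rfl | rfl | rfl) g A hA
    · simp_all
    · obtain ⟨a, rfl⟩ := Submodule.mem_span_singleton.mp hA
      simpa using hA
    · rw [LinearMap.mem_ker, traceLinearMap_apply] at hA ⊢
      rw [trace_mul_cycle]
      simpa using hA
    · exact Submodule.mem_top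

theorem finrank_ker_trace (h2 : (2 : K) ≠ 0) :
    Module.finrank K (LinearMap.ker (traceLinearMap (Fin 2) K K)) = 3 := by
  have h := Submodule.finrank_add_eq_of_isCompl (isCompl_span_one_ker_trace h2)
  rw [finrank_span_singleton one_ne_zero, Module.finrank_matrix] at h
  simp at h
  omega

end Matrix

/-- Let `p ≥ 5` be a prime. The `ℤ/pℤ`-submodules of `M₂(ℤ/pℤ)`
stable under conjugation by every element of `GL₂(ℤ/pℤ)` are exactly `0`, the
scalar matrices, the trace-zero matrices, and the whole space; moreover
`M₂(ℤ/pℤ)` is the internal direct sum of the scalars and the trace-zero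
matrices, and every nonzero proper invariant submodule has dimension `1` or `3`. -/
theorem conjugation_invariant_submodules (p : ℕ) [Fact p.Prime] (hp5 : 5 ≤ p) :
    (∀ W : Submodule (ZMod p) (Matrix (Fin 2) (Fin 2) (ZMod p)),
      (∀ g : GL (Fin 2) (ZMod p), ∀ A ∈ W,
          (g : Matrix (Fin 2) (Fin 2) (ZMod p)) * A *
            ((g⁻¹ : GL (Fin 2) (ZMod p)) : Matrix (Fin 2) (Fin 2) (ZMod p)) ∈ W) ↔
        (W = ⊥ ∨ W = Submodule.span (ZMod p) {(1 : Matrix (Fin 2) (Fin 2) (ZMod p))} ∨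
          W = LinearMap.ker (Matrix.traceLinearMap (Fin 2) (ZMod p) (ZMod p)) ∨ W = ⊤)) ∧
    IsCompl (Submodule.span (ZMod p) {(1 : Matrix (Fin 2) (Fin 2) (ZMod p))})
      (LinearMap.ker (Matrix.traceLinearMap (Fin 2) (ZMod p) (ZMod p))) ∧
    (∀ W : Submodule (ZMod p) (Matrix (Fin 2) (Fin 2) (ZMod p)),
      (∀ g : GL (Fin 2) (ZMod p), ∀ A ∈ W,
          (g : Matrix (Fin 2) (Fin 2) (ZMod p)) * A *
            ((g⁻¹ : GL (Fin 2) (ZMod p)) : Matrix (Fin 2) (Fin 2) (ZMod p)) ∈ W) →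
        W ≠ ⊥ → W ≠ ⊤ →
        Module.finrank (ZMod p) W = 1 ∨ Module.finrank (ZMod p) W = 3) := by
  have h2 : (2 : ZMod p) ≠ 0 := Ring.two_ne_zero (by rw [ZMod.ringChar_zmod_n]; omega)
  refine ⟨fun W ↦ isConjInvariant_iff h2, isCompl_span_one_ker_trace h2, fun W hW hbot htop ↦ ?_⟩
  rcases (isConjInvariant_iff h2).mp hW with h | rfl | rfl | h
  · exact absurd h hbot
  · exact Or.inl (finrank_span_singleton one_ne_zero)
  · exact Or.inr (finrank_ker_trace h2)
  · exact absurd h htop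
end

section
/- Let p be an odd prime and n ≥ 1 an integer. Every element x of the multiplicative group ℚ_p^× can be written as x = p^a · (1+p)^b · y^(pⁿ) with integers a, b and y ∈ ℚ_p^×. Moreover, the quotient group ℚ_p^×/(ℚ_p^×)^(pⁿ) is isomorphic to (ℤ/pⁿℤ) × (ℤ/pⁿℤ), with the classes of p and of 1+p each having order exactly pⁿ and together generating the quotient, the intersection of the two cyclic subgroups they generate being trivial. -/
theorem IsCyclic.mem_zpowers_of_pow_orderOf_eq_one {G : Type*} [Group G] [Finite G] [IsCyclic G]
    {e x : G} (h : x ^ orderOf e = 1) : x ∈ Subgroup.zpowers e := by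
  classical
  have := Fintype.ofFinite G
  have hsub : Finset.univ.filter (· ∈ Subgroup.zpowers e) ⊆
      Finset.univ.filter (fun y : G => y ^ orderOf e = 1) := by
    intro y hy
    obtain ⟨k, rfl⟩ := Subgroup.mem_zpowers_iff.mp (Finset.mem_filter.mp hy).2
    rw [Finset.mem_filter, ← zpow_natCast, zpow_comm, zpow_natCast, pow_orderOf_eq_one, one_zpow]
    exact ⟨Finset.mem_univ _, rfl⟩
  have hcard : (Finset.univ.filter (· ∈ Subgroup.zpowers e)).card = orderOf e := by
    rw [← Fintype.card_zpowers, Fintype.card_subtype]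
  have heq := Finset.eq_of_subset_of_card_le hsub
    ((IsCyclic.card_pow_eq_one_le (orderOf_pos e)).trans hcard.ge)
  have hx : x ∈ Finset.univ.filter (fun y : G => y ^ orderOf e = 1) := by simpa using h
  rw [← heq] at hx
  exact (Finset.mem_filter.mp hx).2

namespace PadicInt

variable {p : ℕ} [Fact p.Prime]

theorem exists_units_pow_eq_of_toZModPow_eq_one {n : ℕ} {u : ℤ_[p]ˣ}
    (hu : toZModPow (2 * n + 1) (u : ℤ_[p]) = 1) : ∃ v : ℤ_[p]ˣ, v ^ p ^ n = u := by
  have hp : 1 < (p : ℝ) := mod_cast (Fact.out : p.Prime).one_lt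
  have hmem : (u : ℤ_[p]) - 1 ∈ Ideal.span {(p : ℤ_[p]) ^ (2 * n + 1)} := by
    rw [← ker_toZModPow, RingHom.mem_ker, map_sub, hu, map_one, sub_self]
  have hnorm := (norm_le_pow_iff_mem_span_pow _ _).mpr hmem
  obtain ⟨z, hz, -⟩ := hensels_lemma
    (F := (Polynomial.X ^ p ^ n - Polynomial.C (u : ℤ_[p]) : Polynomial ℤ_[p])) (a := (1 : ℤ_[p])) (by
      have hd : ‖(p : ℤ_[p]) ^ n‖ ^ 2 = (p : ℝ) ^ (-(2 * n : ℕ) : ℤ) := by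
        rw [← norm_pow, ← pow_mul, mul_comm, norm_p_pow]
      simp only [Polynomial.coe_aeval_eq_eval, Polynomial.eval_sub, Polynomial.eval_pow,
        Polynomial.eval_X, Polynomial.eval_C, one_pow, Polynomial.derivative_sub,
        Polynomial.derivative_X_pow, Polynomial.derivative_C, sub_zero, Polynomial.eval_mul,
        mul_one, Nat.cast_pow]
      rw [hd, norm_sub_rev]
      refine hnorm.trans_lt (zpow_lt_zpow_right₀ hp ?_)
      push_cast
      omega)
  have hz' : z ^ p ^ n = u := by simpa [sub_eq_zero] using hz
  have hzu : IsUnit z :=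
    (isUnit_pow_iff (pow_ne_zero n (Fact.out : p.Prime).ne_zero)).mp (hz' ▸ u.isUnit)
  exact ⟨hzu.unit, Units.ext hz'⟩

theorem orderOf_map_toZModPow_one_add_prime (hp2 : p ≠ 2) {e : ℤ_[p]ˣ}
    (he : (e : ℤ_[p]) = 1 + p) (m : ℕ) :
    orderOf (Units.map (toZModPow (p := p) (m + 1)).toMonoidHom e) = p ^ m := by
  rw [← ZMod.orderOf_one_add_prime Fact.out hp2 m, ← orderOf_units]
  simp [he]

theorem units_zmod_prime_pow_pow_eq_one {m : ℕ} (y : (ZMod (p ^ (m + 1)))ˣ) :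
    (y ^ (p - 1)) ^ p ^ m = 1 := by
  rw [← pow_mul, mul_comm, ← Nat.totient_prime_pow_succ Fact.out, ZMod.pow_totient]

theorem isCoprime_prime_pow_sub_one (p : ℕ) [Fact p.Prime] (n : ℕ) :
    IsCoprime ((p ^ n : ℕ) : ℤ) ((p - 1 : ℕ) : ℤ) := by
  rw [Nat.cast_pow]
  refine IsCoprime.pow_left ⟨1, -1, ?_⟩
  rw [Nat.cast_pred (Fact.out : p.Prime).pos]
  ring

theorem exists_units_eq_zpow_mul_pow (hp2 : p ≠ 2) {e : ℤ_[p]ˣ} (he : (e : ℤ_[p]) = 1 + p)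
    (n : ℕ) (u : ℤ_[p]ˣ) : ∃ (b : ℤ) (v : ℤ_[p]ˣ), u = e ^ b * v ^ p ^ n := by
  set φ := Units.map (toZModPow (p := p) (2 * n + 1)).toMonoidHom
  have hord := orderOf_map_toZModPow_one_add_prime hp2 he (2 * n)
  have := ZMod.isCyclic_units_of_prime_pow p Fact.out hp2 (2 * n + 1)
  obtain ⟨k, hk⟩ := Subgroup.mem_zpowers_iff.mp <|
    IsCyclic.mem_zpowers_of_pow_orderOf_eq_one (e := φ e) (x := φ u ^ (p - 1)) (by
      rw [hord, units_zmod_prime_pow_pow_eq_one])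
  obtain ⟨s, t, hst⟩ := isCoprime_prime_pow_sub_one p n
  have hw : φ (u * (e ^ (k * t) * (u ^ s) ^ p ^ n)⁻¹) = 1 := by
    rw [map_mul, map_inv, mul_inv_eq_one, map_mul, map_zpow, map_pow, map_zpow, zpow_mul, hk]
    calc φ u = φ u ^ (s * (p ^ n : ℕ) + t * (p - 1 : ℕ)) := by rw [hst, zpow_one]
      _ = _ := by
        rw [add_comm (s * _), zpow_add, mul_comm t, zpow_mul, zpow_mul, zpow_natCast, zpow_natCast]
  obtain ⟨v, hv⟩ := exists_units_pow_eq_of_toZModPow_eq_one (n := n) (congrArg Units.val hw)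
  refine ⟨k * t, v * u ^ s, ?_⟩
  rw [mul_pow, mul_left_comm, hv, inv_mul_cancel_right]

theorem pow_dvd_of_zpow_eq_units_pow (hp2 : p ≠ 2) {e : ℤ_[p]ˣ} (he : (e : ℤ_[p]) = 1 + p)
    {n : ℕ} {b : ℤ} {v : ℤ_[p]ˣ} (h : e ^ b = v ^ p ^ n) : ((p ^ n : ℕ) : ℤ) ∣ b := by
  set φ := Units.map (toZModPow (p := p) (n + 1)).toMonoidHom
  have hord := orderOf_map_toZModPow_one_add_prime hp2 he n
  have h1 : φ e ^ (b * (p - 1 : ℕ)) = 1 := by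
    rw [zpow_mul, ← map_zpow, h, map_pow, zpow_natCast, pow_right_comm,
      units_zmod_prime_pow_pow_eq_one]
  have h2 := orderOf_dvd_iff_zpow_eq_one.mpr h1
  rw [hord] at h2
  exact (isCoprime_prime_pow_sub_one p n).dvd_of_dvd_mul_right h2

end PadicInt

namespace Padic

variable {p : ℕ} [Fact p.Prime]

theorem exists_units_eq_zpow_mul_map {π : ℚ_[p]ˣ} (hπ : (π : ℚ_[p]) = p) (x : ℚ_[p]ˣ) :
    ∃ u : ℤ_[p]ˣ,
      x = π ^ (x : ℚ_[p]).valuation * Units.map PadicInt.Coe.ringHom.toMonoidHom u := by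
  have hp : (p : ℝ) ≠ 0 := mod_cast (Fact.out : p.Prime).ne_zero
  have hn : ‖((π ^ (-(x : ℚ_[p]).valuation) * x : ℚ_[p]ˣ) : ℚ_[p])‖ = 1 := by
    rw [Units.val_mul, Units.val_zpow_eq_zpow_val, hπ, norm_mul, norm_p_zpow,
      norm_eq_zpow_neg_valuation x.ne_zero, neg_neg, ← zpow_add₀ hp, add_neg_cancel, zpow_zero]
  refine ⟨PadicInt.mkUnits hn, ?_⟩
  have : Units.map PadicInt.Coe.ringHom.toMonoidHom (PadicInt.mkUnits hn) =
      π ^ (-(x : ℚ_[p]).valuation) * x := Units.ext (PadicInt.mkUnits_eq hn)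
  rw [this, zpow_neg, mul_inv_cancel_left]

theorem eq_zero_of_zpow_eq_map_units {π : ℚ_[p]ˣ} (hπ : (π : ℚ_[p]) = p) {a : ℤ} {u : ℤ_[p]ˣ}
    (h : π ^ a = Units.map PadicInt.Coe.ringHom.toMonoidHom u) : a = 0 := by
  have hp : 1 < (p : ℝ) := mod_cast (Fact.out : p.Prime).one_lt
  have hn : ‖(p : ℚ_[p]) ^ a‖ = 1 := by
    rw [← hπ, ← Units.val_zpow_eq_zpow_val, h]
    exact PadicInt.norm_units u
  rw [norm_p_zpow] at hn
  simpa using zpow_right_injective₀ (by positivity) hp.ne' (hn.trans (zpow_zero _).symm)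

theorem exists_units_map_eq_one_add_prime {ε : ℚ_[p]ˣ} (hε : (ε : ℚ_[p]) = 1 + p) :
    ∃ e : ℤ_[p]ˣ, (e : ℤ_[p]) = 1 + p ∧ Units.map PadicInt.Coe.ringHom.toMonoidHom e = ε := by
  have hu : IsUnit (1 + p : ℤ_[p]) :=
    (IsLocalRing.isUnit_or_isUnit_of_add_one (show (-p : ℤ_[p]) + (1 + p) = 1 by ring)).resolve_left
      (by rw [IsUnit.neg_iff]; exact PadicInt.prime_p.not_isUnit)
  exact ⟨hu.unit, rfl, Units.ext (by simp [hε])⟩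

theorem exists_units_eq_zpow_mul_zpow_mul_pow (hp2 : p ≠ 2) (n : ℕ) {π ε : ℚ_[p]ˣ}
    (hπ : (π : ℚ_[p]) = p) (hε : (ε : ℚ_[p]) = 1 + p) (x : ℚ_[p]ˣ) :
    ∃ (a b : ℤ) (y : ℚ_[p]ˣ), x = π ^ a * ε ^ b * y ^ p ^ n := by
  obtain ⟨e, he, rfl⟩ := exists_units_map_eq_one_add_prime hε
  obtain ⟨u, hu⟩ := exists_units_eq_zpow_mul_map hπ x
  obtain ⟨b, v, hv⟩ := PadicInt.exists_units_eq_zpow_mul_pow hp2 he n u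
  refine ⟨(x : ℚ_[p]).valuation, b, Units.map PadicInt.Coe.ringHom.toMonoidHom v, hu.trans ?_⟩
  rw [hv, map_mul, map_zpow, map_pow, mul_assoc]

theorem zpow_mul_zpow_mem_range_powMonoidHom_iff (hp2 : p ≠ 2) {n : ℕ} {π ε : ℚ_[p]ˣ}
    (hπ : (π : ℚ_[p]) = p) (hε : (ε : ℚ_[p]) = 1 + p) (a b : ℤ) :
    π ^ a * ε ^ b ∈ (powMonoidHom (p ^ n) : ℚ_[p]ˣ →* ℚ_[p]ˣ).range ↔
      ((p ^ n : ℕ) : ℤ) ∣ a ∧ ((p ^ n : ℕ) : ℤ) ∣ b := by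
  constructor
  · rintro ⟨y, hy⟩
    rw [powMonoidHom_apply] at hy
    obtain ⟨e, he, rfl⟩ := exists_units_map_eq_one_add_prime hε
    obtain ⟨u, hu⟩ := exists_units_eq_zpow_mul_map hπ y
    set v := (y : ℚ_[p]).valuation
    set ι := Units.map (PadicInt.Coe.ringHom (p := p)).toMonoidHom
    have hι : Function.Injective ι := Units.map_injective Subtype.val_injective
    have key : π ^ (a - v * (p ^ n : ℕ)) = ι (u ^ p ^ n * (e ^ b)⁻¹) := by
      rw [map_mul, map_inv, map_zpow, map_pow, zpow_sub, zpow_mul, zpow_natCast,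
        mul_inv_eq_iff_eq_mul, mul_right_comm, eq_mul_inv_iff_mul_eq, ← hy, hu, mul_pow, mul_comm]
    have ha := eq_zero_of_zpow_eq_map_units hπ key
    rw [ha, zpow_zero, ← map_one ι] at key
    exact ⟨⟨v, by rw [mul_comm, ← sub_eq_zero, ha]⟩,
      PadicInt.pow_dvd_of_zpow_eq_units_pow hp2 he (mul_inv_eq_one.mp (hι key).symm).symm⟩
  · rintro ⟨⟨c, rfl⟩, d, rfl⟩
    refine ⟨π ^ c * ε ^ d, ?_⟩
    rw [powMonoidHom_apply, mul_pow, mul_comm _ c, mul_comm _ d, zpow_mul, zpow_mul, zpow_natCast,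
      zpow_natCast]

end Padic

section Group

variable {G : Type*} [Group G] {N : ℕ} {x y : G}

theorem orderOf_eq_of_zpow_eq_one_iff_dvd
    (h : ∀ a : ℤ, x ^ a = 1 ↔ (N : ℤ) ∣ a) : orderOf x = N := by
  refine Nat.dvd_antisymm ?_ ?_
  · exact Int.natCast_dvd_natCast.mp (orderOf_dvd_iff_zpow_eq_one.mpr ((h N).mpr dvd_rfl))
  · exact Int.natCast_dvd_natCast.mp ((h _).mp (orderOf_dvd_iff_zpow_eq_one.mp dvd_rfl))

theorem zpowers_inf_zpowers_eq_bot
    (h : ∀ a b : ℤ, x ^ a * y ^ b = 1 ↔ (N : ℤ) ∣ a ∧ (N : ℤ) ∣ b) :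
    Subgroup.zpowers x ⊓ Subgroup.zpowers y = ⊥ := by
  rw [eq_bot_iff]
  rintro _ ⟨⟨a, rfl⟩, b, hb⟩
  have ha : (N : ℤ) ∣ a := ((h a (-b)).mp (by
    simp only at hb
    rw [zpow_neg, hb, mul_inv_cancel])).1
  have h1 := (h a 0).mpr ⟨ha, dvd_zero _⟩
  rwa [zpow_zero, mul_one] at h1

theorem closure_pair_eq_top_of_forall_exists_zpow
    (h : ∀ g : G, ∃ a b : ℤ, x ^ a * y ^ b = g) : Subgroup.closure {x, y} = ⊤ :=
  eq_top_iff.mpr fun g _ => by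
    obtain ⟨a, b, rfl⟩ := h g
    exact mul_mem (zpow_mem (Subgroup.subset_closure (by simp)) a)
      (zpow_mem (Subgroup.subset_closure (by simp)) b)

theorem nonempty_mulEquiv_zmod_prod_zmod {G : Type*} [CommGroup G] {N : ℕ} {x y : G}
    (h : ∀ a b : ℤ, x ^ a * y ^ b = 1 ↔ (N : ℤ) ∣ a ∧ (N : ℤ) ∣ b)
    (hg : ∀ g : G, ∃ a b : ℤ, x ^ a * y ^ b = g) :
    Nonempty (G ≃* Multiplicative (ZMod N) × Multiplicative (ZMod N)) := by
  let φ (z : G) (hz : z ^ (N : ℤ) = 1) : Multiplicative (ZMod N) →* G :=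
    AddMonoidHom.toMultiplicativeLeft (ZMod.lift N ⟨zmultiplesHom (Additive G) (.ofMul z), by
      rw [zmultiplesHom_apply, ← ofMul_zpow, hz, ofMul_one]⟩)
  have hφ (z : G) (hz : z ^ (N : ℤ) = 1) (a : ℤ) : φ z hz (.ofAdd (a : ZMod N)) = z ^ a := by
    simp [φ]
  have hx : x ^ (N : ℤ) = 1 := by simpa using (h N 0).mpr ⟨dvd_rfl, dvd_zero _⟩
  have hy : y ^ (N : ℤ) = 1 := by simpa using (h 0 N).mpr ⟨dvd_zero _, dvd_rfl⟩
  refine ⟨(MulEquiv.ofBijective ((φ x hx).coprod (φ y hy)) ⟨?_, fun g => ?_⟩).symm⟩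
  · rw [injective_iff_map_eq_one]
    rintro ⟨a, b⟩ hab
    induction a with | ofAdd a => ?_
    induction b with | ofAdd b => ?_
    obtain ⟨a, rfl⟩ := ZMod.intCast_surjective a
    obtain ⟨b, rfl⟩ := ZMod.intCast_surjective b
    rw [MonoidHom.coprod_apply, hφ x hx, hφ y hy, h, ← ZMod.intCast_zmod_eq_zero_iff_dvd,
      ← ZMod.intCast_zmod_eq_zero_iff_dvd] at hab
    rw [hab.1, hab.2]
    rfl
  · obtain ⟨a, b, rfl⟩ := hg g
    exact ⟨(.ofAdd a, .ofAdd b), by rw [MonoidHom.coprod_apply, hφ x hx, hφ y hy]⟩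

end Group


/-- Let `p` be an odd prime and `n ≥ 1`. Every `x ∈ ℚ_p^×` can be
written as `x = p^a · (1+p)^b · y^(pⁿ)`, and the quotient `ℚ_p^×/(ℚ_p^×)^(pⁿ)` is
isomorphic to `(ℤ/pⁿℤ) × (ℤ/pⁿℤ)`, the classes of `p` and `1+p` each having order
exactly `pⁿ`, generating the quotient, and generating cyclic subgroups with
trivial intersection. -/
theorem padic_units_mod_pow_structure (p : ℕ) [Fact p.Prime] (hodd : Odd p)
    (n : ℕ) (hn : 1 ≤ n) (π ε : ℚ_[p]ˣ) (hπ : (π : ℚ_[p]) = (p : ℚ_[p]))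
    (hε : (ε : ℚ_[p]) = 1 + (p : ℚ_[p])) :
    (∀ x : ℚ_[p]ˣ, ∃ (a b : ℤ) (y : ℚ_[p]ˣ), x = π ^ a * ε ^ b * y ^ (p ^ n)) ∧
    orderOf (QuotientGroup.mk π : ℚ_[p]ˣ ⧸ (powMonoidHom (p ^ n) : ℚ_[p]ˣ →* ℚ_[p]ˣ).range) = p ^ n ∧
    orderOf (QuotientGroup.mk ε : ℚ_[p]ˣ ⧸ (powMonoidHom (p ^ n) : ℚ_[p]ˣ →* ℚ_[p]ˣ).range) = p ^ n ∧
    Subgroup.closure {(QuotientGroup.mk π : ℚ_[p]ˣ ⧸ (powMonoidHom (p ^ n) : ℚ_[p]ˣ →* ℚ_[p]ˣ).range),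
      QuotientGroup.mk ε} = ⊤ ∧
    Subgroup.zpowers (QuotientGroup.mk π : ℚ_[p]ˣ ⧸ (powMonoidHom (p ^ n) : ℚ_[p]ˣ →* ℚ_[p]ˣ).range) ⊓
      Subgroup.zpowers (QuotientGroup.mk ε : ℚ_[p]ˣ ⧸ (powMonoidHom (p ^ n) : ℚ_[p]ˣ →* ℚ_[p]ˣ).range) = ⊥ ∧
    Nonempty ((ℚ_[p]ˣ ⧸ (powMonoidHom (p ^ n) : ℚ_[p]ˣ →* ℚ_[p]ˣ).range) ≃*
      (Multiplicative (ZMod (p ^ n)) × Multiplicative (ZMod (p ^ n)))) := by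
  have hp2 : p ≠ 2 := by
    rintro rfl
    exact absurd hodd (by decide)
  have hex := Padic.exists_units_eq_zpow_mul_zpow_mul_pow hp2 n hπ hε
  set H := (powMonoidHom (p ^ n) : ℚ_[p]ˣ →* ℚ_[p]ˣ).range
  have hrel (a b : ℤ) : (π : ℚ_[p]ˣ ⧸ H) ^ a * (ε : ℚ_[p]ˣ ⧸ H) ^ b = 1 ↔
      ((p ^ n : ℕ) : ℤ) ∣ a ∧ ((p ^ n : ℕ) : ℤ) ∣ b := by
    rw [← Padic.zpow_mul_zpow_mem_range_powMonoidHom_iff hp2 hπ hε, ← QuotientGroup.mk_zpow,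
      ← QuotientGroup.mk_zpow, ← QuotientGroup.mk_mul, QuotientGroup.eq_one_iff]
  have hgen (g : ℚ_[p]ˣ ⧸ H) : ∃ a b : ℤ, (π : ℚ_[p]ˣ ⧸ H) ^ a * (ε : ℚ_[p]ˣ ⧸ H) ^ b = g := by
    obtain ⟨x, rfl⟩ := QuotientGroup.mk_surjective g
    obtain ⟨a, b, y, rfl⟩ := hex x
    exact ⟨a, b, QuotientGroup.eq.mpr ⟨y, (inv_mul_cancel_left _ _).symm⟩⟩
  refine ⟨hex, ?_, ?_, ?_, ?_, ?_⟩
  · exact orderOf_eq_of_zpow_eq_one_iff_dvd fun a => by simpa using hrel a 0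
  · exact orderOf_eq_of_zpow_eq_one_iff_dvd fun b => by simpa using hrel 0 b
  · exact closure_pair_eq_top_of_forall_exists_zpow (G := ℚ_[p]ˣ ⧸ H) hgen
  · exact zpowers_inf_zpowers_eq_bot (G := ℚ_[p]ˣ ⧸ H) hrel
  · exact nonempty_mulEquiv_zmod_prod_zmod (G := ℚ_[p]ˣ ⧸ H) hrel hgen
end
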